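/- arXiv:2112.15223 — 2 statements merged into one kernel-verified Lean document; each statement's English description precedes it below -/
import Mathlib

section
/- Let M be an even positive integer and γ = (a b; c d) ∈ Γ(2M) (i.e. a ≡ d ≡ 1 mod 2M and b ≡ c ≡ 0 mod 2M) with c > 0. Let f : ℤ → ℂ be M-periodic, and define g(r) := Σ_{ℓ mod cM, ℓ ≡ r mod M} e^{iπ a ℓ²/(cM)} and h(n) := (cM)^{-1/2} e^{iπ b d n²/M} Σ_{r mod M} f(r + dn) g(r) e^{2πi b n r/M}. Then h(n) = e^{iπ/4} (2Mc/|d|) f(n) for all n ∈ ℤ, where (2Mc/|d|) is the Jacobi symbol. -/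
open Complex
open scoped Real
open Filter Topology

lemma ofReal_mul_cpow {x : ℝ} (hx : 0 < x) {s : ℂ} (hs : s ≠ 0) (r : ℂ) :
    ((x : ℂ) * s) ^ r = (x : ℂ) ^ r * s ^ r := by
  have hx' : (x : ℂ) ≠ 0 := by exact_mod_cast hx.ne'
  rw [cpow_def_of_ne_zero (mul_ne_zero hx' hs), cpow_def_of_ne_zero hs, cpow_def_of_ne_zero hx',
    log_ofReal_mul hx hs, ofReal_log hx.le, add_mul, Complex.exp_add]

lemma ofReal_cpow_half {x : ℝ} (hx : 0 ≤ x) : (x : ℂ) ^ (1 / 2 : ℂ) = (√x : ℝ) := by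
  rw [Real.sqrt_eq_rpow, ofReal_cpow hx]
  norm_num

lemma sq_mul_cpow_half {x : ℝ} (hx : 0 < x) {s : ℂ} (hs : s ≠ 0) :
    ((x : ℂ) ^ 2 * s) ^ (1 / 2 : ℂ) = x * s ^ (1 / 2 : ℂ) := by
  rw [← ofReal_pow, ofReal_mul_cpow (by positivity) hs, ofReal_cpow_half (by positivity),
    Real.sqrt_sq hx.le]

lemma hasSum_gaussian_residue {N : ℕ} (hN : 0 < N) (r : ℤ) {s : ℂ} (hs : 0 < s.re) :
    HasSum (fun k : ℤ => cexp (-π * ((r + N * k : ℤ) : ℂ) ^ 2 * s))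
      (1 / (N * s ^ (1 / 2 : ℂ)) * jacobiTheta₂ (r / N) (I / (N ^ 2 * s))) := by
  have hs0 : s ≠ 0 := by rintro rfl; simp at hs
  have hNr : (0 : ℝ) < N := by exact_mod_cast hN
  have hN0 : (N : ℂ) ≠ 0 := by exact_mod_cast hN.ne'
  have him : 0 < (I * (N ^ 2 * s)).im := by
    have : (I * ((N : ℂ) ^ 2 * s)).im = (N : ℝ) ^ 2 * s.re := by
      rw [I_mul_im]
      have : ((N : ℂ) ^ 2) = (((N : ℝ) ^ 2 : ℝ) : ℂ) := by push_cast; rfl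
      rw [this, re_ofReal_mul]
    rw [this]; positivity
  have h := (hasSum_jacobiTheta₂_term (I * (r * N * s)) him).mul_left (cexp (-π * r ^ 2 * s))
  rw [jacobiTheta₂_functional_equation] at h
  convert! h using 1
  · funext k
    simp only [jacobiTheta₂_term]
    rw [← Complex.exp_add]
    congr 1
    push_cast
    linear_combination (-(2 * π * k * r * N * s) - π * k ^ 2 * N ^ 2 * s) * I_sq
  · have h1 : -I * (I * (N ^ 2 * s)) = ((N : ℝ) : ℂ) ^ 2 * s := by
      push_cast; linear_combination (-(N ^ 2 * s)) * I_sq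
    have h2 : I * (r * N * s) / (I * (N ^ 2 * s)) = r / N := by field_simp
    have h3 : -1 / (I * (N ^ 2 * s)) = I / (N ^ 2 * s) := by
      field_simp; simp
    have h4 : -π * I * (I * (r * N * s)) ^ 2 / (I * (N ^ 2 * s)) = -(-π * r ^ 2 * s) := by
      field_simp; simp
    rw [h1, sq_mul_cpow_half hNr hs0, h2, h3, h4]
    have := Complex.exp_ne_zero (-π * r ^ 2 * s)
    rw [Complex.exp_neg]
    push_cast
    field_simp

lemma norm_jacobiTheta₂_sub_one_le (x : ℝ) {τ : ℂ} (hτ : 0 < τ.im) :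
    ‖jacobiTheta₂ x τ - 1‖ ≤ 2 / (1 - Real.exp (-π * τ.im)) * Real.exp (-π * τ.im) := by
  set y := Real.exp (-π * τ.im)
  have hy0 : 0 < y := Real.exp_pos _
  have hy1 : y < 1 := Real.exp_lt_one_iff.mpr (by nlinarith [Real.pi_pos])
  have h := hasSum_jacobiTheta₂_term x hτ
  have hb (n : ℤ) : ‖jacobiTheta₂_term n x τ‖ ≤ y ^ n.natAbs := by
    refine le_trans (le_of_eq ?_) (norm_exp_mul_sq_le hτ n)
    rw [norm_jacobiTheta₂_term, ofReal_im, Complex.norm_exp]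
    congr 1
    have : (π * I * (n : ℂ) ^ 2 * τ) = ((π * n ^ 2 : ℝ) : ℂ) * (I * τ) := by push_cast; ring
    rw [this, re_ofReal_mul, I_mul_re]; ring
  have h' := h.nat_add_neg
  rw [← hasSum_nat_add_iff' 1] at h'
  simp only [Finset.sum_range_one] at h'
  have hg : HasSum (fun n : ℕ => 2 * (y * y ^ n)) (2 * (y * (1 - y)⁻¹)) :=
    ((hasSum_geometric_of_lt_one hy0.le hy1).mul_left y).mul_left 2
  have h0 : jacobiTheta₂_term 0 x τ = 1 := by simp [jacobiTheta₂_term]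
  have := h'.norm_le_of_bounded hg (fun n => by
    refine (norm_add_le _ _).trans ?_
    have h1 := hb ((n + 1 : ℕ) : ℤ)
    have h2 := hb (-((n + 1 : ℕ) : ℤ))
    rw [Int.natAbs_neg] at h2
    rw [Int.natAbs_natCast, pow_succ'] at h1 h2
    linarith)
  convert this using 1
  · congr 1
    simp [h0]
  · rw [div_eq_mul_inv]; ring

lemma tendsto_jacobiTheta₂_one (x : ℝ) {l : Filter ℝ} {τ : ℝ → ℂ}
    (hτ : Tendsto (fun t => (τ t).im) l atTop) :
    Tendsto (fun t => jacobiTheta₂ x (τ t)) l (𝓝 1) := by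
  rw [tendsto_iff_norm_sub_tendsto_zero]
  have he : Tendsto (fun t => Real.exp (-π * (τ t).im)) l (𝓝 0) :=
    Real.tendsto_exp_atBot.comp (hτ.const_mul_atTop_of_neg (by linarith [Real.pi_pos]))
  have hlim : Tendsto (fun t => 2 / (1 - Real.exp (-π * (τ t).im)) * Real.exp (-π * (τ t).im)) l
      (𝓝 (2 / (1 - 0) * 0)) :=
    (tendsto_const_nhds.div (tendsto_const_nhds.sub he) (by norm_num)).mul he
  rw [mul_zero] at hlim
  refine squeeze_zero' (.of_forall fun _ => norm_nonneg _) ?_ hlim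
  filter_upwards [hτ.eventually_gt_atTop 0] with t ht
  exact norm_jacobiTheta₂_sub_one_le x ht

/-- A Gaussian sum with periodic weights `w`, rescaled by `s ^ (1 / 2)`, tends to the mean of `w`
as `s → 0` with `Re (1 / s) → ∞`. -/
lemma tendsto_periodic_gaussian_sum {N : ℕ} (hN : 0 < N) {w : ℤ → ℂ}
    (hw : ∀ r k : ℤ, w (r + N * k) = w r) {l : Filter ℝ} {s : ℝ → ℂ} {F : ℝ → ℂ}
    (hs : Tendsto (fun t => ((s t)⁻¹).re) l atTop)
    (hF : ∀ᶠ t in l, HasSum (fun n : ℤ => w n * cexp (-π * (n : ℂ) ^ 2 * s t)) (F t)) :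
    Tendsto (fun t => (s t) ^ (1 / 2 : ℂ) * F t) l
      (𝓝 ((∑ r ∈ Finset.range N, w r) / N)) := by
  have hN0 : (N : ℂ) ≠ 0 := by exact_mod_cast hN.ne'
  have : NeZero N := ⟨hN.ne'⟩
  have key : ∀ᶠ t in l, (∑ r : Fin N, w (r : ℕ) *
      jacobiTheta₂ (((r : ℕ) / N : ℝ) : ℂ) (I / (N ^ 2 * s t))) / N =
      (s t) ^ (1 / 2 : ℂ) * F t := by
    filter_upwards [hs.eventually_gt_atTop 0, hF] with t ht hFt
    have hs0 : s t ≠ 0 := by intro h; simp [h] at ht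
    have hre : 0 < (s t).re := by
      rw [inv_re] at ht
      exact (div_pos_iff_of_pos_right (normSq_pos.mpr hs0)).mp ht
    have hst : (s t) ^ (1 / 2 : ℂ) ≠ 0 := by simp [cpow_eq_zero_iff, hs0]
    have h1 := ((Equiv.prodComm _ _).trans (Int.divModEquiv N).symm).hasSum_iff.mpr hFt
    have h2 : ∀ r : Fin N, HasSum (fun k : ℤ => ((fun n : ℤ => w n * cexp (-π * (n : ℂ) ^ 2 * s t)) ∘
        ((Equiv.prodComm _ _).trans (Int.divModEquiv N).symm)) (r, k))
        (w (r : ℕ) * (1 / (N * (s t) ^ (1 / 2 : ℂ)) *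
          jacobiTheta₂ (((r : ℕ) : ℤ) / N) (I / (N ^ 2 * s t)))) := by
      intro r
      convert! (hasSum_gaussian_residue hN ((r : ℕ) : ℤ) hre).mul_left (w (r : ℕ)) using 1
      · funext k
        have : (Int.divModEquiv N).symm (k, r) = (r : ℕ) + N * k := by
          rw [Int.divModEquiv_symm_apply]; ring
        simp only [Function.comp_apply, Equiv.trans_apply, Equiv.prodComm_apply, Prod.swap_prod_mk,
          this, hw]
    have h3 := (h1.prod_fiberwise h2).unique (hasSum_fintype _)
    rw [h3, Finset.sum_div, Finset.mul_sum]
    refine Finset.sum_congr rfl fun r _ => ?_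
    push_cast
    field_simp
  refine Tendsto.congr' key ?_
  rw [← Fin.sum_univ_eq_sum_range (fun r => w r)]
  refine Tendsto.div_const (tendsto_finsetSum _ fun r _ => ?_) _
  have : Tendsto (fun t => (I / (N ^ 2 * s t)).im) l atTop := by
    have h : ∀ t, (I / (N ^ 2 * s t)).im = ((N : ℝ) ^ 2)⁻¹ * ((s t)⁻¹).re := by
      intro t
      have : I / (N ^ 2 * s t) = I * (((((N : ℝ) ^ 2)⁻¹ : ℝ) : ℂ) * (s t)⁻¹) := by
        push_cast; rw [div_eq_mul_inv, mul_inv]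
      rw [this, I_mul_im, re_ofReal_mul]
    simp_rw [h]
    exact hs.const_mul_atTop (by positivity)
  simpa using (tendsto_jacobiTheta₂_one (((r : ℕ) / N : ℝ)) this).const_mul (w (r : ℕ))

/-- The Landsberg–Schaar reciprocity law for quadratic Gauss sums, from the behaviour of Jacobi's
theta function at the cusps `2 * q / p` and `-p / (2 * q)`. -/
theorem landsberg_schaar {p q : ℕ} (hp : 0 < p) (hq : 0 < q) :
    (∑ n ∈ Finset.range p, cexp (2 * π * I * q * n ^ 2 / p)) / p =
      (√(2 * q / p) : ℝ) * cexp (π * I / 4) *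
        ((∑ n ∈ Finset.range (2 * q), cexp (-(π * I * p * n ^ 2 / (2 * q)))) / (2 * q)) := by
  have hp0 : (p : ℂ) ≠ 0 := by exact_mod_cast hp.ne'
  have hq0 : (q : ℂ) ≠ 0 := by exact_mod_cast hq.ne'
  set x : ℝ := 2 * q / p with hx
  have hxpos : 0 < x := by positivity
  have hx0 : (x : ℂ) ≠ 0 := by exact_mod_cast hxpos.ne'
  have hxc : (x : ℂ) = 2 * q / p := by rw [hx]; push_cast; rfl
  set τ : ℝ → ℂ := fun t => x + I * t with hτ
  have hτre (t : ℝ) : (τ t).re = x := by simp [hτ]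
  have hτim (t : ℝ) : (τ t).im = t := by simp [hτ]
  have hτ0 (t : ℝ) : τ t ≠ 0 := fun h => by
    have := hτre t
    rw [h, zero_re] at this
    exact hxpos.ne this
  have hτlim : Tendsto τ (𝓝[>] 0) (𝓝 x) := by
    have : Continuous τ := by fun_prop
    simpa [hτ] using (this.tendsto 0).mono_left nhdsWithin_le_nhds
  have hpos : ∀ᶠ t : ℝ in 𝓝[>] 0, 0 < t := self_mem_nhdsWithin
  have lim₁ := tendsto_periodic_gaussian_sum (l := 𝓝[>] (0 : ℝ)) hp
    (w := fun n => cexp (2 * π * I * q * n ^ 2 / p)) (s := fun t => (t : ℂ))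
    (F := fun t => jacobiTheta₂ 0 (τ t))
    (by
      intro r k
      rw [Complex.exp_eq_exp_iff_exists_int]
      refine ⟨q * (2 * r * k + p * k ^ 2), ?_⟩
      push_cast
      field_simp
      ring)
    (by
      simp_rw [← ofReal_inv, ofReal_re]
      exact tendsto_inv_nhdsGT_zero)
    (by
      filter_upwards [hpos] with t ht
      convert hasSum_jacobiTheta₂_term 0 (τ := τ t) (by rwa [hτim]) using 1
      funext n
      simp only [jacobiTheta₂_term]
      rw [← Complex.exp_add]
      congr 1
      rw [hτ, hxc]
      linear_combination (-(π * n ^ 2 * t)) * I_sq)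
  have lim₂ := tendsto_periodic_gaussian_sum (l := 𝓝[>] (0 : ℝ)) (N := 2 * q) (by positivity)
    (w := fun n => cexp (-(π * I * p * n ^ 2 / (2 * q))))
    (s := fun t => (t : ℂ) * (x * τ t)⁻¹)
    (F := fun t => jacobiTheta₂ 0 (-1 / τ t))
    (by
      intro r k
      rw [Complex.exp_eq_exp_iff_exists_int]
      refine ⟨-(p * (r * k + q * k ^ 2)), ?_⟩
      push_cast
      field_simp
      ring)
    (by
      have h : ∀ t : ℝ, (((t : ℂ) * (x * τ t)⁻¹)⁻¹).re = x ^ 2 * t⁻¹ := by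
        intro t
        have : ((t : ℂ) * (x * τ t)⁻¹)⁻¹ = ((x * t⁻¹ : ℝ) : ℂ) * τ t := by
          rw [mul_inv, inv_inv]; push_cast; ring
        rw [this, re_ofReal_mul, hτre]; ring
      simp_rw [h]
      exact tendsto_inv_nhdsGT_zero.const_mul_atTop (by positivity))
    (by
      filter_upwards [hpos] with t ht
      convert hasSum_jacobiTheta₂_term 0 (τ := -1 / τ t) (by
        rw [neg_div, neg_im, one_div, inv_im, hτim, neg_div, neg_neg]
        exact div_pos ht (normSq_pos.mpr (hτ0 t))) using 1
      funext n
      simp only [jacobiTheta₂_term]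
      rw [← Complex.exp_add]
      congr 1
      have h1 : (π * I * p * n ^ 2 / (2 * q) : ℂ) = π * I * n ^ 2 / x := by
        rw [hxc]; field_simp
      rw [h1]
      have := hτ0 t
      field_simp
      simp only [hτ]
      linear_combination (-(n ^ 2 * t : ℂ)) * I_sq)
  have hratio : Tendsto (fun t => (((x * τ t)⁻¹) ^ (1 / 2 : ℂ) * (-I * τ t) ^ (1 / 2 : ℂ))⁻¹)
      (𝓝[>] 0) (𝓝 ((((x * x : ℂ)⁻¹) ^ (1 / 2 : ℂ) * (-I * x) ^ (1 / 2 : ℂ))⁻¹)) := by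
    have h1 : (x * x : ℂ)⁻¹ ∈ slitPlane := by
      rw [← ofReal_mul, ← ofReal_inv, ofReal_mem_slitPlane]; positivity
    have h2 : -I * x ∈ slitPlane := by
      rw [mem_slitPlane_iff]; right; simpa using hxpos.ne'
    have hne : ((x * x : ℂ)⁻¹) ^ (1 / 2 : ℂ) * (-I * x) ^ (1 / 2 : ℂ) ≠ 0 := by
      simp [cpow_eq_zero_iff, hx0]
    refine Tendsto.inv₀ (Tendsto.mul ?_ ?_) hne
    · exact ((hτlim.const_mul _).inv₀ (mul_ne_zero hx0 hx0)).cpow tendsto_const_nhds h1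
    · exact (hτlim.const_mul _).cpow tendsto_const_nhds h2
  have hlim := hratio.mul lim₂
  have heq : ∀ᶠ t : ℝ in 𝓝[>] 0, (((x * τ t)⁻¹) ^ (1 / 2 : ℂ) * (-I * τ t) ^ (1 / 2 : ℂ))⁻¹ *
      (((t : ℂ) * (x * τ t)⁻¹) ^ (1 / 2 : ℂ) * jacobiTheta₂ 0 (-1 / τ t)) =
      (t : ℂ) ^ (1 / 2 : ℂ) * jacobiTheta₂ 0 (τ t) := by
    filter_upwards [hpos] with t ht
    have h1 : (x * τ t)⁻¹ ≠ 0 := inv_ne_zero (mul_ne_zero hx0 (hτ0 t))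
    have h2 : ((x * τ t)⁻¹) ^ (1 / 2 : ℂ) ≠ 0 := by
      rw [Ne, cpow_eq_zero_iff]; tauto
    have h3 : (-I * τ t) ^ (1 / 2 : ℂ) ≠ 0 := by
      simp [cpow_eq_zero_iff, hτ0 t]
    rw [jacobiTheta₂_functional_equation 0 (τ t), ofReal_mul_cpow ht h1, mul_inv]
    simp only [zero_div, ne_eq, OfNat.ofNat_ne_zero, not_false_eq_true, zero_pow, mul_zero,
      Complex.exp_zero]
    linear_combination ((-I * τ t) ^ (1 / 2 : ℂ))⁻¹ * (t : ℂ) ^ (1 / 2 : ℂ) *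
      jacobiTheta₂ 0 (-1 / τ t) * inv_mul_cancel₀ h2
  have hfin := tendsto_nhds_unique lim₁ (hlim.congr' heq)
  have hc : (((x * x : ℂ)⁻¹) ^ (1 / 2 : ℂ) * (-I * x) ^ (1 / 2 : ℂ))⁻¹ =
      (√x : ℝ) * cexp (π * I / 4) := by
    have h1 : ((x * x : ℂ)⁻¹) ^ (1 / 2 : ℂ) = (x : ℂ)⁻¹ := by
      rw [← ofReal_mul, ← ofReal_inv, ofReal_cpow_half (by positivity), Real.sqrt_inv,
        Real.sqrt_mul_self hxpos.le, ofReal_inv]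
    have h2 : (-I * x : ℂ) ^ (1 / 2 : ℂ) = (√x : ℝ) * (cexp (π * I / 4))⁻¹ := by
      rw [mul_comm, ofReal_mul_cpow hxpos (neg_ne_zero.mpr I_ne_zero), ofReal_cpow_half hxpos.le,
        cpow_def_of_ne_zero (neg_ne_zero.mpr I_ne_zero), log_neg_I, ← Complex.exp_neg]
      congr 2
      ring
    have h3 : ((√x : ℝ) : ℂ) * (√x : ℝ) = x := by
      rw [← ofReal_mul, Real.mul_self_sqrt hxpos.le]
    have h4 : ((√x : ℝ) : ℂ) ≠ 0 := by
      rw [ofReal_ne_zero]; positivity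
    have h5 := Complex.exp_ne_zero (π * I / 4)
    rw [h1, h2]
    field_simp
    linear_combination -h3
  rw [hc] at hfin
  exact_mod_cast hfin

lemma sum_addChar_sq_eq_gaussSum {F : Type*} [Field F] [Fintype F] [DecidableEq F]
    (hF : ringChar F ≠ 2) {ψ : AddChar F ℂ} (hψ : ψ ≠ 1) :
    ∑ x : F, ψ (x ^ 2) = gaussSum ((quadraticChar F).ringHomComp (Int.castRingHom ℂ)) ψ := by
  have h : ∑ x : F, ψ (x ^ 2) = ∑ y : F, ((quadraticChar F y + 1 : ℤ) : ℂ) * ψ y := by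
    rw [← Finset.sum_fiberwise_of_maps_to (s := Finset.univ) (t := Finset.univ)
      (g := fun x : F => x ^ 2) (fun _ _ => Finset.mem_univ _)]
    refine Finset.sum_congr rfl fun y _ => ?_
    rw [← quadraticChar_card_sqrts hF y,
      Finset.sum_congr rfl (g := fun _ => ψ y) (by
        intro x hx; rw [(Finset.mem_filter.mp hx).2]), Finset.sum_const, nsmul_eq_mul]
    congr 2
    congr 1
    ext x
    simp
  rw [h]
  simp only [Int.cast_add, Int.cast_one, add_mul, one_mul, Finset.sum_add_distrib,
    AddChar.sum_eq_zero_of_ne_one hψ, add_zero]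
  rfl

lemma sum_range_eq_sum_zmod {p : ℕ} [NeZero p] (f : ZMod p → ℂ) :
    ∑ n ∈ Finset.range p, f (n : ZMod p) = ∑ x : ZMod p, f x := by
  refine Finset.sum_nbij' (fun n => (n : ZMod p)) ZMod.val ?_ ?_ ?_ ?_ ?_
  · simp
  · intro x _; simpa using ZMod.val_lt x
  · intro n hn; exact ZMod.val_cast_of_lt (Finset.mem_range.mp hn)
  · intro x _; simp
  · simp

lemma stdAddChar_natCast {p : ℕ} [NeZero p] (n : ℕ) :
    ZMod.stdAddChar (n : ZMod p) = cexp (2 * π * I * n / p) := by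
  have := ZMod.stdAddChar_coe (N := p) (n : ℤ)
  push_cast at this
  exact this

theorem quadratic_gauss_sum_mul {p : ℕ} [hp : Fact p.Prime] (hp2 : p ≠ 2) {k : ℕ}
    (hk : ¬ p ∣ k) :
    ∑ n ∈ Finset.range p, cexp (2 * π * I * k * n ^ 2 / p) =
      (jacobiSym k p : ℤ) * ∑ n ∈ Finset.range p, cexp (2 * π * I * n ^ 2 / p) := by
  have hF : ringChar (ZMod p) ≠ 2 := by rwa [ZMod.ringChar_zmod_n]
  have hk0 : (k : ZMod p) ≠ 0 := by rwa [Ne, ZMod.natCast_eq_zero_iff]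
  have key (m : ℕ) : ∑ n ∈ Finset.range p, cexp (2 * π * I * m * n ^ 2 / p) =
      ∑ x : ZMod p, (AddChar.mulShift ZMod.stdAddChar (m : ZMod p)) (x ^ 2) := by
    rw [← sum_range_eq_sum_zmod]
    refine Finset.sum_congr rfl fun n _ => ?_
    rw [AddChar.mulShift_apply]
    have := stdAddChar_natCast (p := p) (m * n ^ 2)
    push_cast at this
    rw [this]
    congr 1
    ring
  have hprim := ZMod.isPrimitive_stdAddChar p
  have hone : (ZMod.stdAddChar (N := p)) ≠ 1 := by
    have := hprim one_ne_zero
    rwa [AddChar.mulShift_one] at this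
  have key1 := key 1
  simp only [Nat.cast_one, mul_one, AddChar.mulShift_one] at key1
  rw [key k, key1, sum_addChar_sq_eq_gaussSum hF (hprim hk0), sum_addChar_sq_eq_gaussSum hF hone]
  set χ := (quadraticChar (ZMod p)).ringHomComp (Int.castRingHom ℂ) with hχ
  have hq : χ.IsQuadratic := (quadraticChar_isQuadratic _).comp _
  have := gaussSum_mulShift_eq χ (ZMod.stdAddChar (N := p)) (Units.mk0 (k : ZMod p) hk0)
  rw [Units.val_mk0, hq.inv] at this
  rw [this, ← jacobiSym.legendreSym.to_jacobiSym, legendreSym]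
  congr 1
  simp [hχ, MulChar.ringHomComp_apply]

lemma jacobiSym_eq_one_of_natCast_eq {k m : ℕ} (hk : 0 < k)
    (h : (m : ℤ) ≡ 1 [ZMOD 4 * k] ∨ (m : ℤ) ≡ -1 [ZMOD 4 * k]) : jacobiSym k m = 1 := by
  have hodd : Odd m := by
    rw [Nat.odd_iff]
    rcases h with h | h <;>
    · have := h.dvd
      obtain ⟨t, ht⟩ := this
      have : ∃ u : ℤ, u = k * t := ⟨_, rfl⟩
      obtain ⟨u, hu⟩ := this
      rw [mul_assoc, ← hu] at ht
      omega
  rcases h with h | h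
  · rw [jacobiSym.mod_right _ hodd]
    have : m % (4 * (k : ℤ).natAbs) = 1 := by
      rw [Int.natAbs_natCast]
      have := h.eq
      rw [Int.emod_eq_of_lt (a := 1) (by norm_num) (by omega)] at this
      exact_mod_cast this
    rw [this, jacobiSym.one_right]
  · have h4 : jacobiSym (4 * k) (4 * k - 1) = 1 := by
      rw [jacobiSym.mod_left' (a₂ := 1), jacobiSym.one_left]
      apply Int.ModEq.symm
      rw [Int.modEq_iff_dvd]
      exact ⟨1, by push_cast [show 1 ≤ 4 * k by omega]; ring⟩
    have hodd' : Odd (4 * k - 1) := by rw [Nat.odd_iff]; omega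
    rw [jacobiSym.mul_left, jacobiSym.at_four hodd', one_mul] at h4
    rw [jacobiSym.mod_right _ hodd, ← h4, jacobiSym.mod_right _ hodd']
    congr 1
    rw [Int.natAbs_natCast]
    change m ≡ 4 * k - 1 [MOD 4 * k]
    rw [← Int.natCast_modEq_iff]
    push_cast [show 1 ≤ 4 * k by omega]
    refine h.trans ?_
    rw [Int.modEq_iff_dvd]
    exact ⟨1, by ring⟩

lemma jacobiSym_eq_of_mul_modEq_one {k p : ℕ} {d : ℤ} (hk : 0 < k)
    (h : (p : ℤ) * d ≡ 1 [ZMOD 4 * k]) : jacobiSym k d.natAbs = jacobiSym k p := by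
  have hpd : jacobiSym k (p * d.natAbs) = 1 := by
    apply jacobiSym_eq_one_of_natCast_eq hk
    push_cast
    rcases abs_choice d with hd | hd
    · left; rwa [hd]
    · right; rw [hd, mul_neg]; exact h.neg
  have hne : (p : ℤ) * d ≠ 0 := fun h0 => by
    have h1 := (Int.isUnit_iff.mp (isUnit_of_dvd_one ((dvd_mul_right 4 (k : ℤ)).trans
      (by simpa [h0] using h.dvd))))
    omega
  have hp0 : p ≠ 0 := by rintro rfl; simp at hne
  have hd0 : d.natAbs ≠ 0 := by rw [Int.natAbs_ne_zero]; exact right_ne_zero_of_mul hne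
  rw [jacobiSym.mul_right' _ hp0 hd0] at hpd
  rcases jacobiSym.trichotomy (k : ℤ) p with h1 | h1 | h1 <;> rw [h1] at hpd ⊢ <;> linarith

lemma exp_pi_mul_I_div_four_mul : cexp (π * I / 4) * (1 - I) = (√2 : ℝ) := by
  have h : (π * I / 4 : ℂ) = ((π / 4 : ℝ) : ℂ) * I := by push_cast; ring
  have h2 : ((√2 : ℝ) : ℂ) ^ 2 = 2 := by rw [← ofReal_pow, Real.sq_sqrt zero_le_two]; norm_num
  rw [h, exp_mul_I, ← ofReal_cos, ← ofReal_sin, Real.cos_pi_div_four, Real.sin_pi_div_four]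
  push_cast
  linear_combination (-((√2 : ℝ) : ℂ) / 2) * I_sq

theorem quadratic_gauss_sum_of_mod_four_eq_one {p : ℕ} (hp : p % 4 = 1) :
    ∑ n ∈ Finset.range p, cexp (2 * π * I * n ^ 2 / p) = (√p : ℝ) := by
  have hp0 : 0 < p := by omega
  have h := landsberg_schaar hp0 one_pos
  have hI : cexp (-(π * I * p / 2)) = -I := by
    obtain ⟨k, rfl⟩ : ∃ k, p = 4 * k + 1 := ⟨p / 4, by omega⟩
    have : -(π * I * (4 * k + 1 : ℕ) / 2) = -(π / 2 * I) + (-k : ℤ) * (2 * π * I) := by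
      push_cast
      ring
    rw [this, Complex.exp_add, exp_int_mul_two_pi_mul_I, mul_one, Complex.exp_neg,
      exp_pi_div_two_mul_I, inv_I]
  simp only [Nat.cast_one, mul_one, Finset.sum_range_succ, Finset.range_zero, Finset.sum_empty,
    zero_add, Nat.cast_zero, one_pow] at h
  rw [hI] at h
  have hpc : (p : ℂ) ≠ 0 := by exact_mod_cast hp0.ne'
  have hs0 : ((√p : ℝ) : ℂ) ≠ 0 := by
    rw [ofReal_ne_zero]; positivity
  have hsp : ((√p : ℝ) : ℂ) ^ 2 = p := by
    rw [← ofReal_pow, Real.sq_sqrt (Nat.cast_nonneg p)]; simp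
  have h2 : ((√2 : ℝ) : ℂ) ^ 2 = 2 := by rw [← ofReal_pow, Real.sq_sqrt zero_le_two]; norm_num
  rw [Real.sqrt_div zero_le_two, div_eq_iff hpc] at h
  rw [h]
  push_cast
  simp only [ne_eq, OfNat.ofNat_ne_zero, not_false_eq_true, zero_pow, mul_zero, zero_div, neg_zero,
    Complex.exp_zero, ← sub_eq_add_neg]
  field_simp
  rw [← hsp]
  linear_combination (√p : ℝ) ^ 2 * (√2 : ℝ) * exp_pi_mul_I_div_four_mul + (√p : ℝ) ^ 2 * h2

theorem sum_exp_quadratic_eq {q : ℕ} (hq : 0 < q) {a d : ℤ} (ha : a % 4 = 1)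
    (had : a * d ≡ 1 [ZMOD 4 * q]) :
    ∑ n ∈ Finset.range (2 * q), cexp (π * I * a * n ^ 2 / (2 * q)) =
      (√(2 * q) : ℝ) * cexp (π * I / 4) * (jacobiSym q d.natAbs : ℤ) := by
  have : NeZero (4 * q) := ⟨by omega⟩
  have hunit : IsUnit (a : ZMod (4 * q)) := by
    refine IsUnit.of_mul_eq_one (d : ZMod (4 * q)) ?_
    have := (ZMod.intCast_eq_intCast_iff (a * d) 1 (4 * q)).mpr (by exact_mod_cast had)
    exact_mod_cast this
  obtain ⟨p, hp2, hp, hpa⟩ := Nat.forall_exists_prime_gt_and_eq_mod hunit 2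
  have hpa' : (p : ℤ) ≡ a [ZMOD 4 * q] := by
    have := (ZMod.intCast_eq_intCast_iff (p : ℤ) a (4 * q)).mp (by exact_mod_cast hpa)
    exact_mod_cast this
  have hp4 : p % 4 = 1 := by
    have := (hpa'.of_mul_right (q : ℤ)).eq
    omega
  have hpq : ¬ p ∣ q := fun h => by
    rw [← hpa] at hunit
    have hcop := (ZMod.isUnit_iff_coprime p (4 * q)).mp hunit
    exact hp.one_lt.ne' (Nat.eq_one_of_dvd_coprimes hcop dvd_rfl (h.mul_left 4))
  have : Fact p.Prime := ⟨hp⟩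
  have hq0 : (q : ℂ) ≠ 0 := by exact_mod_cast hq.ne'
  have hp0 : (p : ℂ) ≠ 0 := by exact_mod_cast hp.ne_zero
  have hsum : ∑ n ∈ Finset.range (2 * q), cexp (π * I * a * n ^ 2 / (2 * q)) =
      (starRingEnd ℂ) (∑ n ∈ Finset.range (2 * q), cexp (-(π * I * p * n ^ 2 / (2 * q)))) := by
    rw [map_sum]
    refine Finset.sum_congr rfl fun n _ => ?_
    obtain ⟨t, ht⟩ := hpa'.dvd
    have hta : (a : ℂ) = p + 4 * q * t := by
      have : a = p + 4 * q * t := by linarith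
      rw [this]; push_cast; ring
    rw [← Complex.exp_conj, Complex.exp_eq_exp_iff_exists_int]
    refine ⟨t * n ^ 2, ?_⟩
    simp only [map_neg, map_div₀, map_mul, map_pow, conj_ofReal, conj_I, map_natCast, map_ofNat]
    rw [hta]
    push_cast
    field_simp
    ring
  have hls := landsberg_schaar hp.pos hq
  rw [quadratic_gauss_sum_mul (by omega) hpq, quadratic_gauss_sum_of_mod_four_eq_one hp4,
    ← jacobiSym_eq_of_mul_modEq_one (d := d) hq ((hpa'.mul_right d).trans had)] at hls
  set T := ∑ n ∈ Finset.range (2 * q), cexp (-(π * I * p * n ^ 2 / (2 * q)))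
  set J : ℤ := jacobiSym q d.natAbs
  have hs0 : ((√p : ℝ) : ℂ) ≠ 0 := by
    have := hp.pos
    rw [ofReal_ne_zero]; positivity
  have hsp : ((√p : ℝ) : ℂ) ^ 2 = p := by
    rw [← ofReal_pow, Real.sq_sqrt (Nat.cast_nonneg p)]; simp
  have hr0 : ((√(2 * q) : ℝ) : ℂ) ≠ 0 := by
    rw [ofReal_ne_zero]; positivity
  have hrq : ((√(2 * q) : ℝ) : ℂ) ^ 2 = 2 * q := by
    rw [← ofReal_pow, Real.sq_sqrt (by positivity)]; simp
  have hE := Complex.exp_ne_zero (π * I / 4)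
  rw [Real.sqrt_div (by positivity), ofReal_div, ← hsp, ← hrq] at hls
  have hT : T = (√(2 * q) : ℝ) * (cexp (π * I / 4))⁻¹ * J := by
    field_simp at hls ⊢
    linear_combination -hls
  have hconj : (starRingEnd ℂ) (cexp (π * I / 4))⁻¹ = cexp (π * I / 4) := by
    rw [← Complex.exp_neg, ← Complex.exp_conj]
    congr 1
    simp only [map_neg, map_div₀, map_mul, conj_ofReal, conj_I, map_ofNat]
    ring
  rw [hsum, hT, map_mul, map_mul, conj_ofReal, hconj, map_intCast]

lemma sum_range_mul_of_quasi_periodic {φ : ℕ → ℂ} {ζ : ℂ} {n : ℕ}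
    (h : ∀ j, φ (n + j) = ζ * φ j) (m : ℕ) :
    ∑ j ∈ Finset.range (n * m), φ j =
      (∑ i ∈ Finset.range m, ζ ^ i) * ∑ j ∈ Finset.range n, φ j := by
  induction m with
  | zero => simp
  | succ m ih =>
    rw [mul_add_one, add_comm, Finset.sum_range_add]
    simp_rw [h]
    rw [← Finset.mul_sum, ih, geom_sum_succ]
    ring

/-- For `M` even and `γ = (a b; c d) ∈ Γ(2M)` with `c > 0`, the transformed
coefficient function `h(n) = (cM)^{-1/2} e^{iπbdn²/M} Σ_{r mod M} f(r+dn) g(r) e^{2πibnr/M}`,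
with `g(r) = Σ_{ℓ mod cM, ℓ≡r mod M} e^{iπaℓ²/(cM)}`, satisfies
`h(n) = e^{iπ/4} (2Mc/|d|) f(n)` for all `n`, where `(·/·)` is the Jacobi symbol. -/
theorem statement18 (M : ℕ) (hM : 0 < M) (hMeven : Even M)
    (a b d : ℤ) (c : ℕ) (hc : 0 < c) (hdet : a * d - b * (c : ℤ) = 1)
    (ha : (2 * (M : ℤ)) ∣ (a - 1)) (hd : (2 * (M : ℤ)) ∣ (d - 1))
    (hb : (2 * (M : ℤ)) ∣ b) (hcc : 2 * M ∣ c)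
    (f : ℤ → ℂ) (hf : ∀ n : ℤ, f (n + M) = f n)
    (g : ℤ → ℂ)
    (hg : ∀ r : ℤ, g r = ∑ j ∈ Finset.range c,
      Complex.exp (Real.pi * Complex.I * (a : ℂ) * ((r : ℂ) + (j : ℂ) * (M : ℂ)) ^ 2 /
        ((c : ℂ) * (M : ℂ))))
    (h : ℤ → ℂ)
    (hh : ∀ n : ℤ, h n = ((Real.sqrt (c * M) : ℝ) : ℂ)⁻¹ *
      Complex.exp (Real.pi * Complex.I * (b : ℂ) * (d : ℂ) * (n : ℂ) ^ 2 / (M : ℂ)) *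
      ∑ r ∈ Finset.range M, f ((r : ℤ) + d * n) * g r *
        Complex.exp (2 * Real.pi * Complex.I * (b : ℂ) * (n : ℂ) * (r : ℂ) / (M : ℂ))) :
    ∀ n : ℤ, h n = Complex.exp (Real.pi * Complex.I / 4) *
      ((jacobiSym (2 * (M : ℤ) * (c : ℤ)) d.natAbs : ℤ) : ℂ) * f n := by
  intro n
  obtain ⟨q, rfl⟩ := hcc
  obtain ⟨b, rfl⟩ := hb
  obtain ⟨d', hd'⟩ := hd
  obtain ⟨a', ha'⟩ := ha
  have hq : 0 < q := Nat.pos_of_mul_pos_left hc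
  have hM0 : (M : ℂ) ≠ 0 := by exact_mod_cast hM.ne'
  have hq0 : (q : ℂ) ≠ 0 := by exact_mod_cast hq.ne'
  push_cast at hdet
  have ha4 : a % 4 = 1 := by
    obtain ⟨k, rfl⟩ := hMeven
    have : a = 1 + 4 * (k * a') := by push_cast at ha'; linarith
    omega
  have had : a * d ≡ 1 [ZMOD 4 * q] :=
    (Int.modEq_iff_dvd.mpr ⟨M ^ 2 * b, by linear_combination hdet⟩).symm
  have hgr (r : ℕ) : g r = (∑ i ∈ Finset.range M, cexp (2 * π * I * (a * r : ℤ) / M) ^ i) *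
      ∑ j ∈ Finset.range (2 * q), cexp (π * I * a * (r + j * M) ^ 2 / ((2 * M * q : ℕ) * M)) := by
    rw [hg, show 2 * M * q = 2 * q * M by ring, ← sum_range_mul_of_quasi_periodic]
    · push_cast; rfl
    · intro j
      rw [← Complex.exp_add, Complex.exp_eq_exp_iff_exists_int]
      refine ⟨a * j + a * q, ?_⟩
      push_cast
      field_simp
      ring
  have hg0 : g 0 = M * ((√(2 * q) : ℝ) * cexp (π * I / 4) * (jacobiSym q d.natAbs : ℤ)) := by
    rw [← sum_exp_quadratic_eq hq ha4 had]
    have := hgr 0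
    push_cast at this
    rw [this]
    simp only [mul_zero, zero_div, Complex.exp_zero, one_pow, Finset.sum_const, Finset.card_range,
      nsmul_eq_mul, mul_one, zero_add]
    congr 1
    refine Finset.sum_congr rfl fun j _ => ?_
    congr 1
    field_simp
  have hgne (r : ℕ) (hr : r ∈ Finset.range M) (hr0 : r ≠ 0) : g r = 0 := by
    rw [hgr]
    have hζ : cexp (2 * π * I * (a * r : ℤ) / M) ≠ 1 := by
      intro h1
      rw [Complex.exp_eq_one_iff] at h1
      obtain ⟨k, hk⟩ := h1
      have hk' : ((a * r : ℤ) : ℂ) = (k * M : ℤ) := by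
        have hpi : (2 * π * I : ℂ) ≠ 0 := two_pi_I_ne_zero
        rw [div_eq_iff hM0] at hk
        apply mul_left_cancel₀ hpi
        rw [hk]; push_cast; ring
      have hk'' : a * r = k * M := by exact_mod_cast hk'
      have hdvd : (M : ℤ) ∣ r := ⟨k - 2 * a' * r, by linear_combination hk'' - (r : ℤ) * ha'⟩
      have := Nat.le_of_dvd (Nat.pos_of_ne_zero hr0) (by exact_mod_cast hdvd)
      exact absurd (Finset.mem_range.mp hr) (by omega)
    have hζM : cexp (2 * π * I * (a * r : ℤ) / M) ^ M = 1 := by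
      rw [← Complex.exp_nat_mul, Complex.exp_eq_one_iff]
      exact ⟨a * r, by field_simp⟩
    rw [geom_sum_eq hζ, hζM, sub_self, zero_div, zero_mul]
  have hfper (m : ℤ) : f (d * m) = f m := by
    have hp : Function.Periodic f (M : ℤ) := hf
    have : d * m = m + (2 * d' * m) * M := by linear_combination m * hd'
    rw [this]
    exact_mod_cast (hp.int_mul (2 * d' * m)) m
  have hexp : cexp (π * I * (2 * M * b : ℤ) * d * n ^ 2 / M) = 1 := by
    rw [Complex.exp_eq_one_iff]
    refine ⟨b * d * n ^ 2, ?_⟩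
    push_cast
    field_simp
  have hJ : jacobiSym (2 * (M : ℤ) * ((2 * M * q : ℕ) : ℤ)) d.natAbs = jacobiSym q d.natAbs := by
    have h1 : (2 * (M : ℤ) * ((2 * M * q : ℕ) : ℤ)) = (2 * M) ^ 2 * q := by push_cast; ring
    have h2 : IsCoprime (2 * (M : ℤ)) d := ⟨-d', 1, by linear_combination hd'⟩
    rw [h1, jacobiSym.mul_left, jacobiSym.sq_one', one_mul]
    rw [Int.gcd, Int.natAbs_natCast]
    exact Int.isCoprime_iff_gcd_eq_one.mp h2
  have hsqrt : √((2 * M * q : ℕ) * M) = M * √(2 * q) := by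
    rw [show (((2 * M * q : ℕ) : ℝ) * M) = M ^ 2 * (2 * q) by push_cast; ring,
      Real.sqrt_mul (by positivity), Real.sqrt_sq (by positivity)]
  have hr0 : ((√(2 * q) : ℝ) : ℂ) ≠ 0 := by
    rw [ofReal_ne_zero]; positivity
  rw [hh, hexp, hJ, hsqrt, Finset.sum_eq_single_of_mem 0 (Finset.mem_range.mpr hM)
    (fun r hr hr0 => by rw [hgne r hr hr0]; simp)]
  simp only [Nat.cast_zero, zero_add, mul_zero, zero_div, Complex.exp_zero, mul_one]
  rw [hfper, hg0, ofReal_mul, ofReal_natCast]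
  field_simp
end

section
/- Let M be an even positive integer and f : ℤ → ℂ an even M-periodic function with mean f = 0, which is an eigenvector of the discrete Fourier transform (U_M f = λ f for some λ ∈ ℂ), and which satisfies the support condition: there exists n₀ ∈ ℤ such that for all n ∈ ℤ, f(n) ≠ 0 implies n² ≡ n₀² mod 2M. Then for every α ∈ ℚ one has mean(f_{α/M}) = 0; that is, Σ_{n mod M_α} f(n) e^{iπ n² α/M} = 0 where M_α := lcm(M, 2·den(α/M)). (In the paper's notation, the set of rationals where the partial theta series has a finite nontangential boundary value is all of ℚ: Q̄_{f,M} = ℚ.) -/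
open Complex

/-- The discrete Fourier transform `U_M f` of an `M`-periodic function `f : ℤ → ℂ`. -/
noncomputable def dft (M : ℕ) (f : ℤ → ℂ) (n : ℤ) : ℂ :=
  (Real.sqrt M : ℂ)⁻¹ * ∑ ℓ ∈ Finset.range M, f ℓ *
    Complex.exp (-2 * Real.pi * Complex.I * ℓ * n / M)

/-- The exponential `x ↦ e^{iπx}`. -/
noncomputable def expPi (x : ℂ) : ℂ := Complex.exp (Real.pi * Complex.I * x)

lemma expPi_add (x y : ℂ) : expPi (x + y) = expPi x * expPi y := by
  simp only [expPi, mul_add, Complex.exp_add]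

lemma expPi_zero : expPi 0 = 1 := by simp [expPi]

lemma expPi_two_mul_int (k : ℤ) : expPi (2 * k) = 1 := by
  rw [expPi, ← Complex.exp_int_mul_two_pi_mul_I k]
  congr 1
  ring

lemma expPi_eq_of_eq_add {x y : ℂ} (k : ℤ) (h : x = y + 2 * k) : expPi x = expPi y := by
  rw [h, expPi_add, expPi_two_mul_int, mul_one]

lemma expPi_pow (x : ℂ) (m : ℕ) : expPi x ^ m = expPi (m * x) := by
  rw [expPi, expPi, ← Complex.exp_nat_mul]
  congr 1
  ring

lemma sum_range_shift_one {g : ℤ → ℂ} {N : ℕ} (hg : ∀ n : ℤ, g (n + N) = g n) :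
    ∑ n ∈ Finset.range N, g (n + 1) = ∑ n ∈ Finset.range N, g n := by
  have h1 := Finset.sum_range_succ (fun n : ℕ => g n) N
  have h2 := Finset.sum_range_succ' (fun n : ℕ => g n) N
  have h3 := hg 0
  rw [zero_add] at h3
  rw [h1] at h2
  push_cast at h2
  rw [h3] at h2
  exact (add_right_cancel h2).symm

lemma sum_range_shift {g : ℤ → ℂ} {N : ℕ} (hg : ∀ n : ℤ, g (n + N) = g n) (t : ℤ) :
    ∑ n ∈ Finset.range N, g (n + t) = ∑ n ∈ Finset.range N, g n := by
  have step : ∀ t : ℤ, ∑ n ∈ Finset.range N, g (n + (t + 1)) =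
      ∑ n ∈ Finset.range N, g (n + t) := fun t => by
    have := sum_range_shift_one (g := fun n => g (n + t)) (N := N)
      (fun n => by rw [show n + (N : ℤ) + t = n + t + N by ring, hg])
    rw [← this]
    exact Finset.sum_congr rfl fun n _ => congrArg g (by ring)
  induction t using Int.induction_on with
  | zero => simp
  | succ i ih => rw [step, ih]
  | pred i ih => rw [← ih, ← step, sub_add_cancel]

lemma sum_range_mul_period {g : ℤ → ℂ} {N : ℕ} (hg : ∀ n : ℤ, g (n + N) = g n) (k : ℕ) :
    ∑ n ∈ Finset.range (k * N), g n = k * ∑ n ∈ Finset.range N, g n := by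
  induction k with
  | zero => simp
  | succ k ih =>
    have h : ∑ n ∈ Finset.range N, g ((k * N + n : ℕ) : ℤ) = ∑ n ∈ Finset.range N, g n := by
      rw [← sum_range_shift hg (k * N)]
      exact Finset.sum_congr rfl fun n _ => congrArg g (by push_cast; ring)
    rw [add_mul, one_mul, Finset.sum_range_add, ih, h]
    push_cast
    ring

lemma sum_range_eq_zero_of_periods {g : ℤ → ℂ} {A B : ℕ} (hA : 0 < A)
    (hgA : ∀ n : ℤ, g (n + A) = g n) (hgB : ∀ n : ℤ, g (n + B) = g n)
    (h : ∑ n ∈ Finset.range A, g n = 0) : ∑ n ∈ Finset.range B, g n = 0 := by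
  have h1 := sum_range_mul_period hgA B
  have h2 := sum_range_mul_period hgB A
  rw [h, mul_zero, mul_comm B A] at h1
  rw [h1] at h2
  exact (mul_eq_zero.mp h2.symm).resolve_left (by exact_mod_cast hA.ne')

lemma sum_expPi_eq_zero {p : ℕ} (hp : 0 < p) (d : ℤ) (hd : ¬ (p : ℤ) ∣ d) :
    ∑ m ∈ Finset.range p, expPi (2 * d * m / p) = 0 := by
  have hp' : (p : ℂ) ≠ 0 := by exact_mod_cast hp.ne'
  have h1 : expPi (2 * d / p) ≠ 1 := by
    intro h
    rw [expPi, Complex.exp_eq_one_iff] at h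
    obtain ⟨n, hn⟩ := h
    apply hd
    refine ⟨n, ?_⟩
    have hpi : (2 * Real.pi * Complex.I : ℂ) ≠ 0 := Complex.two_pi_I_ne_zero
    have h2 : (2 * Real.pi * Complex.I : ℂ) * d = (2 * Real.pi * Complex.I) * (p * n) := by
      field_simp at hn
      linear_combination (2 * Real.pi * Complex.I) * hn
    exact_mod_cast mul_left_cancel₀ hpi h2
  have h2 : ∀ m ∈ Finset.range p, expPi (2 * d * m / p) = expPi (2 * d / p) ^ m := fun m _ => by
    rw [expPi_pow]
    congr 1
    ring
  rw [Finset.sum_congr rfl h2, geom_sum_eq h1, expPi_pow, mul_div_cancel₀ _ hp',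
    expPi_two_mul_int, sub_self, zero_div]

lemma natCast_mul_eq_sum_expPi {p : ℕ} (hp : 0 < p) {w : ℤ → ℂ}
    (hw : ∀ n : ℤ, w (n + p) = w n) (l : ℤ) :
    (p : ℂ) * w l = ∑ r ∈ Finset.range p, w r *
      ∑ m ∈ Finset.range p, expPi (2 * ((r : ℤ) - l : ℤ) * m / p) := by
  have hp' : (p : ℂ) ≠ 0 := by exact_mod_cast hp.ne'
  have hg : ∀ n : ℤ, w (n + p) * ∑ m ∈ Finset.range p, expPi (2 * (n + p - l : ℤ) * m / p) =
      w n * ∑ m ∈ Finset.range p, expPi (2 * (n - l : ℤ) * m / p) := fun n => by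
    rw [hw]
    congr 1
    refine Finset.sum_congr rfl fun m _ => expPi_eq_of_eq_add m ?_
    push_cast
    field_simp
    ring
  rw [← sum_range_shift (g := fun r => w r *
    ∑ m ∈ Finset.range p, expPi (2 * (r - l : ℤ) * m / p)) hg l,
    Finset.sum_eq_single_of_mem 0 (Finset.mem_range.mpr hp)]
  · simp [expPi_zero, mul_comm]
  · intro r hr hr0
    rw [sum_expPi_eq_zero hp, mul_zero]
    intro h
    rw [add_sub_cancel_right] at h
    have := Nat.le_of_dvd (Nat.pos_of_ne_zero hr0) (Int.natCast_dvd_natCast.mp h)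
    exact absurd (Finset.mem_range.mp hr) (by omega)

/-- A function on `{0, …, N-1}` orthogonal to all characters modulo `p` is orthogonal to all
`p`-periodic functions. -/
lemma sum_mul_periodic_eq_zero {p N : ℕ} (hp : 0 < p) {F w : ℤ → ℂ}
    (hw : ∀ n : ℤ, w (n + p) = w n)
    (hF : ∀ n : ℤ, ∑ l ∈ Finset.range N, F l * expPi (2 * l * n / p) = 0) :
    ∑ l ∈ Finset.range N, F l * w l = 0 := by
  have key : ∀ l : ℤ, F l * ((p : ℂ) * w l) = ∑ r ∈ Finset.range p, ∑ m ∈ Finset.range p,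
      w r * expPi (2 * r * m / p) * (F l * expPi (2 * l * (-m : ℤ) / p)) := fun l => by
    rw [natCast_mul_eq_sum_expPi hp hw, Finset.mul_sum]
    refine Finset.sum_congr rfl fun r _ => ?_
    rw [Finset.mul_sum, Finset.mul_sum]
    refine Finset.sum_congr rfl fun m _ => ?_
    rw [show (2 * ((r : ℤ) - l : ℤ) * m / p : ℂ) = 2 * r * m / p + 2 * l * (-m : ℤ) / p by
      push_cast; ring, expPi_add]
    ring
  have h : (p : ℂ) * ∑ l ∈ Finset.range N, F l * w l = 0 := by
    rw [Finset.mul_sum]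
    simp only [mul_left_comm (p : ℂ), key]
    rw [Finset.sum_comm]
    refine Finset.sum_eq_zero fun r _ => ?_
    rw [Finset.sum_comm]
    refine Finset.sum_eq_zero fun m _ => ?_
    have := hF (-m)
    push_cast at this ⊢
    rw [← Finset.mul_sum, this, mul_zero]
  exact (mul_eq_zero.mp h).resolve_left (by exact_mod_cast hp.ne')

/-- The Gauss-type sum `∑_{n mod qM} e^{iπ(pn² - 2qln)/(qM)}`. -/
noncomputable def gaussSumAux (M p q : ℕ) (l : ℤ) : ℂ :=
  ∑ n ∈ Finset.range (q * M), expPi (p * n ^ 2 / (q * M) - 2 * l * n / M)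

lemma gaussSumAux_add_modulus {M p q : ℕ} (hM : 0 < M) (l : ℤ) :
    gaussSumAux M p q (l + M) = gaussSumAux M p q l := by
  have hM' : (M : ℂ) ≠ 0 := by exact_mod_cast hM.ne'
  refine Finset.sum_congr rfl fun n _ => expPi_eq_of_eq_add (-n) ?_
  push_cast
  field_simp
  ring

lemma gaussSumAux_add {M p q : ℕ} (hM : 0 < M) (hMeven : Even M) (hq : 0 < q) (l : ℤ) :
    gaussSumAux M p q (l + p) = expPi (-((p * q + 2 * l * q) / M)) * gaussSumAux M p q l := by
  have hM' : (M : ℂ) ≠ 0 := by exact_mod_cast hM.ne'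
  have hq' : (q : ℂ) ≠ 0 := by exact_mod_cast hq.ne'
  have hg : ∀ n : ℤ, expPi (p * (n + (q * M : ℕ) : ℤ) ^ 2 / (q * M) -
      2 * l * (n + (q * M : ℕ) : ℤ) / M) = expPi (p * n ^ 2 / (q * M) - 2 * l * n / M) := by
    intro n
    obtain ⟨K, rfl⟩ := hMeven.two_dvd
    refine expPi_eq_of_eq_add (p * n + p * q * K - l * q) ?_
    push_cast at hM' ⊢
    have hK := right_ne_zero_of_mul hM'
    field_simp
    ring
  have h := sum_range_shift (g := fun n => expPi (p * n ^ 2 / (q * M) - 2 * l * n / M)) hg (-q)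
  simp only [Int.cast_natCast] at h
  rw [gaussSumAux, gaussSumAux, ← h, Finset.mul_sum]
  refine Finset.sum_congr rfl fun n _ => ?_
  rw [← expPi_add]
  congr 1
  push_cast
  field_simp
  ring

section Reciprocity

variable {M : ℕ} {f : ℤ → ℂ}

lemma dft_eq_sum_expPi (n : ℤ) :
    dft M f n = (Real.sqrt M : ℂ)⁻¹ * ∑ l ∈ Finset.range M, f l * expPi (-(2 * l * n / M)) := by
  rw [dft]
  congr 1
  refine Finset.sum_congr rfl fun l _ => ?_
  rw [expPi]
  congr 2
  ring

lemma eq_zero_of_dft_eq_zero (hM : 0 < M) (hf : ∀ n : ℤ, f (n + M) = f n)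
    (h : ∀ n, dft M f n = 0) (n : ℤ) : f n = 0 := by
  have hs : (Real.sqrt M : ℂ)⁻¹ ≠ 0 := by
    have : Real.sqrt M ≠ 0 := (Real.sqrt_pos.mpr (by exact_mod_cast hM)).ne'
    exact inv_ne_zero (by exact_mod_cast this)
  have h1 : ∑ l ∈ Finset.range M, f l * (starRingEnd ℂ) (f l) = 0 := by
    refine sum_mul_periodic_eq_zero hM (w := fun n => (starRingEnd ℂ) (f n))
      (fun n => by simp only [hf]) fun n => ?_
    have := h (-n)
    rw [dft_eq_sum_expPi] at this
    rw [← (mul_eq_zero.mp this).resolve_left hs]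
    refine Finset.sum_congr rfl fun l _ => ?_
    congr 2
    push_cast
    ring
  have h2 : ∑ l ∈ Finset.range M, Complex.normSq (f l) = 0 := by
    simp only [Complex.mul_conj] at h1
    exact_mod_cast h1
  have h3 : f n = f ((n % M).toNat) := by
    rw [Int.toNat_of_nonneg (Int.emod_nonneg _ (by omega))]
    have h4 : Function.Periodic f (M : ℤ) := hf
    conv_lhs => rw [← Int.emod_add_mul_ediv n M, mul_comm]
    simpa using (h4.int_mul (n / M)) (n % M)
  rw [h3, ← Complex.normSq_eq_zero]
  refine (Finset.sum_eq_zero_iff_of_nonneg fun l _ => Complex.normSq_nonneg _).mp h2 _ ?_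
  have := Int.emod_lt_of_pos n (b := M) (by omega)
  exact Finset.mem_range.mpr (by omega)

/-- Vanishing of the twisted mean at `-q/p` yields vanishing at `p/q`. -/
lemma twisted_sum_eq_zero_of_neg_inv (hM : 0 < M) (hMeven : Even M)
    (hf : ∀ n : ℤ, f (n + M) = f n) {c : ℂ}
    (hc : ∀ n : ℤ, f n = c * ∑ l ∈ Finset.range M, f l * expPi (-(2 * l * n / M)))
    {p q : ℕ} (hp : 0 < p) (hq : 0 < q) (hpq : IsCoprime (p : ℤ) q)
    (h : ∑ n ∈ Finset.range (p * M), f n * expPi (-(q * n ^ 2 / (p * M))) = 0) :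
    ∑ n ∈ Finset.range (q * M), f n * expPi (p * n ^ 2 / (q * M)) = 0 := by
  have hM' : (M : ℂ) ≠ 0 := by exact_mod_cast hM.ne'
  have hp' : (p : ℂ) ≠ 0 := by exact_mod_cast hp.ne'
  have hq' : (q : ℂ) ≠ 0 := by exact_mod_cast hq.ne'
  have hunfold : ∑ n ∈ Finset.range (q * M), f n * expPi (p * n ^ 2 / (q * M)) =
      c * ∑ l ∈ Finset.range M, f l * gaussSumAux M p q l := by
    simp only [gaussSumAux, Finset.mul_sum]
    rw [Finset.sum_comm]
    refine Finset.sum_congr rfl fun n _ => ?_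
    rw [hc n, Finset.mul_sum, Finset.sum_mul]
    refine Finset.sum_congr rfl fun l _ => ?_
    rw [sub_eq_add_neg, expPi_add]
    push_cast
    ring
  have hfG : ∀ n : ℤ, f (n + M) * gaussSumAux M p q (n + M) = f n * gaussSumAux M p q n :=
    fun n => by rw [hf, gaussSumAux_add_modulus hM]
  have hfp : ∀ n : ℤ, f (n + (p * M : ℕ)) = f n := fun n => by
    have h4 : Function.Periodic f (M : ℤ) := hf
    simpa using (h4.int_mul p) n
  have hF : ∀ n : ℤ, f (n + (p * M : ℕ)) *
      expPi (-(q * (n + (p * M : ℕ) : ℤ) ^ 2 / (p * M))) =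
      f n * expPi (-(q * n ^ 2 / (p * M))) := fun n => by
    rw [hfp]
    congr 1
    obtain ⟨K, rfl⟩ := hMeven.two_dvd
    refine expPi_eq_of_eq_add (-(q * n + p * q * K)) ?_
    push_cast at hM' ⊢
    have hK := right_ne_zero_of_mul hM'
    field_simp
    ring
  have hchar : ∀ n : ℤ, ∑ l ∈ Finset.range (p * M),
      f l * expPi (-(q * (l : ℤ) ^ 2 / (p * M))) * expPi (2 * (l : ℤ) * n / p) = 0 := by
    intro n
    obtain ⟨a, b, hab⟩ := hpq
    have hab' : (a * p + b * q : ℂ) = 1 := by exact_mod_cast hab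
    have hs := sum_range_shift (g := fun n => f n * expPi (-(q * n ^ 2 / (p * M)))) hF
      (-(M * (b * n)))
    simp only [Int.cast_natCast] at hs
    rw [h] at hs
    rw [← mul_zero (expPi (q * M * (b * n) ^ 2 / p)), ← hs, Finset.mul_sum]
    refine Finset.sum_congr rfl fun l _ => ?_
    have hfl : f (l + -(M * (b * n))) = f l := by
      have h4 : Function.Periodic f (M : ℤ) := hf
      have := (h4.int_mul (-(b * n))) l
      rw [← this]
      congr 1
      push_cast
      ring
    rw [hfl, mul_assoc, mul_left_comm (expPi _), ← expPi_add, ← expPi_add]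
    congr 1
    refine expPi_eq_of_eq_add (l * a * n) ?_
    push_cast
    field_simp
    linear_combination (-2 * (l : ℂ) * n * M) * hab'
  have hw : ∀ n : ℤ, gaussSumAux M p q (n + p) * expPi (q * (n + p : ℤ) ^ 2 / (p * M)) =
      gaussSumAux M p q n * expPi (q * n ^ 2 / (p * M)) := fun n => by
    rw [gaussSumAux_add hM hMeven hq, mul_right_comm, mul_comm, ← expPi_add]
    congr 2
    push_cast
    field_simp
    ring
  have hsum := sum_mul_periodic_eq_zero (N := p * M) hp
    (F := fun l => f l * expPi (-(q * l ^ 2 / (p * M))))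
    (w := fun l => gaussSumAux M p q l * expPi (q * l ^ 2 / (p * M))) hw hchar
  have hsum' : ∑ l ∈ Finset.range (p * M), f l * gaussSumAux M p q l = 0 := by
    rw [← hsum]
    refine Finset.sum_congr rfl fun l _ => ?_
    have : expPi (-(q * (l : ℤ) ^ 2 / (p * M))) * expPi (q * (l : ℤ) ^ 2 / (p * M)) = 1 := by
      rw [← expPi_add, neg_add_cancel, expPi_zero]
    linear_combination (-(f l * gaussSumAux M p q l)) * this
  rw [sum_range_mul_period (g := fun l => f l * gaussSumAux M p q l) hfG] at hsum'
  rw [hunfold, (mul_eq_zero.mp hsum').resolve_left hp', mul_zero]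

lemma twisted_sum_eq_zero (hM : 0 < M) (hMeven : Even M)
    (hf : ∀ n : ℤ, f (n + M) = f n) {c : ℂ}
    (hc : ∀ n : ℤ, f n = c * ∑ l ∈ Finset.range M, f l * expPi (-(2 * l * n / M)))
    (hmean : ∑ l ∈ Finset.range M, f l = 0)
    {n₀ : ℤ} (hsupp : ∀ n : ℤ, f n ≠ 0 → (2 * (M : ℤ)) ∣ (n ^ 2 - n₀ ^ 2))
    (q : ℕ) (hq : 0 < q) (p : ℤ) (hpq : IsCoprime p q) :
    ∑ n ∈ Finset.range (q * M), f n * expPi (p * n ^ 2 / (q * M)) = 0 := by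
  induction q using Nat.strong_induction_on generalizing p with
  | _ q ih =>
  have hM' : (M : ℂ) ≠ 0 := by exact_mod_cast hM.ne'
  have hq' : (q : ℂ) ≠ 0 := by exact_mod_cast hq.ne'
  obtain ⟨r, hr⟩ := Int.eq_ofNat_of_zero_le (Int.emod_nonneg p (b := q) (by omega))
  have hrq : r < q := by
    have := Int.emod_lt_of_pos p (b := q) (by omega)
    omega
  have hpr : p = r + q * (p / q) := by rw [← hr, Int.emod_add_mul_ediv]
  generalize p / q = t at hpr
  have hcop : IsCoprime (r : ℤ) q := by
    rw [hpr] at hpq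
    exact IsCoprime.of_add_mul_left_left hpq
  have hterm : ∀ n : ℕ, f n * expPi (p * n ^ 2 / (q * M)) =
      expPi (t * n₀ ^ 2 / M) * (f n * expPi (r * n ^ 2 / (q * M))) := fun n => by
    by_cases hn : f n = 0
    · simp [hn]
    obtain ⟨k, hk⟩ := hsupp n hn
    have hk' : (n ^ 2 - n₀ ^ 2 : ℂ) = 2 * M * k := by exact_mod_cast hk
    rw [mul_left_comm, ← expPi_add]
    congr 1
    refine expPi_eq_of_eq_add (t * k) ?_
    rw [hpr]
    push_cast
    field_simp
    linear_combination (t * q : ℂ) * hk'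
  rw [Finset.sum_congr rfl fun n _ => hterm n, ← Finset.mul_sum]
  refine mul_eq_zero_of_right _ ?_
  rcases Nat.eq_zero_or_pos r with rfl | hr0
  · simp only [Nat.cast_zero, zero_mul, zero_div, expPi_zero, mul_one]
    rw [sum_range_mul_period hf, hmean, mul_zero]
  · refine twisted_sum_eq_zero_of_neg_inv hM hMeven hf hc hr0 hq hcop ?_
    rw [← ih r hrq hr0 (-q) hcop.symm.neg_left]
    refine Finset.sum_congr rfl fun n _ => ?_
    congr 2
    push_cast
    ring

end Reciprocity

/-- Let `M` be even and `f` an even `M`-periodic function with zero mean,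
an eigenvector of `U_M`, whose support satisfies `f(n) ≠ 0 → n² ≡ n₀² mod 2M` for some `n₀`.
Then for every `α ∈ ℚ` the twisted mean vanishes:
`Σ_{n mod M_α} f(n) e^{iπn²α/M} = 0` with `M_α = lcm(M, 2·den(α/M))`; that is, `Q̄_{f,M} = ℚ`. -/
theorem statement19 (M : ℕ) (hM : 0 < M) (hMeven : Even M)
    (f : ℤ → ℂ) (hf : ∀ n : ℤ, f (n + M) = f n) (heven : ∀ n : ℤ, f (-n) = f n)
    (hmean : ∑ ℓ ∈ Finset.range M, f ℓ = 0)
    (lam : ℂ) (hlam : ∀ n : ℤ, dft M f n = lam * f n)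
    (n₀ : ℤ) (hsupp : ∀ n : ℤ, f n ≠ 0 → (2 * (M : ℤ)) ∣ (n ^ 2 - n₀ ^ 2)) :
    ∀ α : ℚ,
      ∑ n ∈ Finset.range (Nat.lcm M (2 * (α / (M : ℚ)).den)),
        f n * Complex.exp (Real.pi * Complex.I * (n : ℂ) ^ 2 * (α : ℂ) / (M : ℂ)) = 0 := by
  intro α
  have hM' : (M : ℂ) ≠ 0 := by exact_mod_cast hM.ne'
  by_cases hlam0 : lam = 0
  · have h0 := eq_zero_of_dft_eq_zero hM hf fun n => by rw [hlam, hlam0, zero_mul]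
    simp [h0]
  have hc : ∀ n : ℤ, f n = lam⁻¹ * (Real.sqrt M : ℂ)⁻¹ *
      ∑ l ∈ Finset.range M, f l * expPi (-(2 * l * n / M)) := fun n => by
    rw [mul_assoc, ← dft_eq_sum_expPi, hlam, inv_mul_cancel_left₀ hlam0]
  have hper : Function.Periodic f (M : ℤ) := hf
  have hmain := twisted_sum_eq_zero hM hMeven hf hc hmean hsupp α.den α.den_pos α.num
    (by rw [Int.isCoprime_iff_gcd_eq_one]; exact α.reduced)
  have hden : (α.den : ℂ) ≠ 0 := by exact_mod_cast α.den_pos.ne'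
  have hα : (α : ℂ) = α.num / α.den := Rat.cast_def α
  set g : ℤ → ℂ := fun n => f n * expPi (n ^ 2 * α / M) with hg
  have hgA : ∀ n : ℤ, g (n + (α.den * M : ℕ)) = g n := fun n => by
    have h1 : f (n + (α.den * M : ℕ)) = f n := by simpa using (hper.int_mul α.den) n
    simp only [hg, h1]
    congr 1
    obtain ⟨K, rfl⟩ := hMeven.two_dvd
    refine expPi_eq_of_eq_add (α.num * n + α.num * α.den * K) ?_
    rw [hα]
    push_cast at hM' ⊢
    have hK := right_ne_zero_of_mul hM'
    field_simp
    ring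
  have hgB : ∀ n : ℤ, g (n + (Nat.lcm M (2 * (α / (M : ℚ)).den) : ℕ)) = g n := fun n => by
    obtain ⟨a, ha⟩ := Nat.dvd_lcm_left M (2 * (α / (M : ℚ)).den)
    obtain ⟨b, hb⟩ := Nat.dvd_lcm_right M (2 * (α / (M : ℚ)).den)
    have h1 : f (n + (Nat.lcm M (2 * (α / (M : ℚ)).den) : ℕ)) = f n := by
      rw [ha, mul_comm]
      simpa using (hper.int_mul a) n
    simp only [hg, h1]
    congr 1
    have hβ : (α / M : ℂ) = (α / (M : ℚ)).num / (α / (M : ℚ)).den := by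
      rw [← Rat.cast_def]
      push_cast
      rfl
    rw [hb]
    generalize (α / (M : ℚ)).num = u at hβ
    have hv : ((α / (M : ℚ)).den : ℂ) ≠ 0 := by exact_mod_cast (α / (M : ℚ)).den_pos.ne'
    generalize (α / (M : ℚ)).den = v at hβ hv
    refine expPi_eq_of_eq_add (2 * n * b * u + 2 * b ^ 2 * v * u) ?_
    rw [mul_div_assoc, mul_div_assoc, hβ]
    push_cast
    field_simp
    ring
  have hzero : ∑ n ∈ Finset.range (α.den * M), g n = 0 := by
    rw [← hmain]
    refine Finset.sum_congr rfl fun n _ => ?_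
    simp only [hg, hα]
    congr 2
    push_cast
    field_simp
  rw [← sum_range_eq_zero_of_periods (Nat.mul_pos α.den_pos hM) hgA hgB hzero]
  refine Finset.sum_congr rfl fun n _ => ?_
  simp only [hg, expPi]
  congr 2
  push_cast
  ring
end
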